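/- arXiv:1608.02817 — 2 statements merged into one kernel-verified Lean document; each statement's English description precedes it below -/
import Mathlib

section
/- For every non-negative integer n, the following identity holds in the field of rational functions Q(q, a, c, x): (∑_{k=0}^{n} (q^{-n};q)_k (a;q)_k (x;q)_k q^k / ((q;q)_k (c;q)_k)) · (∑_{k=0}^{n} (q^{-n};q)_k (a;q)_k (c/x;q)_k q^k / ((q;q)_k (c;q)_k)) = a^n · ∑_{k=0}^{n} (q^{-n};q)_k (c q^n;q)_k (a;q)_k (c/a;q)_k (x;q)_k (c/x;q)_k q^k / ((q;q)_k (c;q)_k (c;q)_{2k}). -/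
open Finset

/-- The q-Pochhammer symbol `(a;q)_n = ∏_{j=0}^{n-1} (1 - a q^j)`. -/
noncomputable def qPoch {F : Type*} [Field F] (q a : F) (n : ℕ) : F :=
  ∏ j ∈ Finset.range n, (1 - a * q ^ j)

/-- The field of rational functions `ℚ(q, a, c, x)`. -/
abbrev F4 : Type := FractionRing (MvPolynomial (Fin 4) ℚ)

noncomputable def q : F4 := algebraMap (MvPolynomial (Fin 4) ℚ) F4 (MvPolynomial.X 0)
noncomputable def a : F4 := algebraMap (MvPolynomial (Fin 4) ℚ) F4 (MvPolynomial.X 1)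
noncomputable def c : F4 := algebraMap (MvPolynomial (Fin 4) ℚ) F4 (MvPolynomial.X 2)
noncomputable def x : F4 := algebraMap (MvPolynomial (Fin 4) ℚ) F4 (MvPolynomial.X 3)


theorem qP_succ {F : Type*} [Field F] (q y : F) (k : ℕ) :
    qPoch q y (k + 1) = qPoch q y k * (1 - y * q ^ k) := by
  simp [qPoch, Finset.prod_range_succ]

theorem qP_zero {F : Type*} [Field F] (q y : F) : qPoch q y 0 = 1 := by
  simp [qPoch]

theorem qP_shift {F : Type*} [Field F] (q y : F) (k : ℕ) :
    (1 - y) * qPoch q (y * q) k = qPoch q y k * (1 - y * q ^ k) := by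
  induction k with
  | zero => simp [qP_zero]
  | succ k ih =>
    rw [qP_succ, qP_succ, ← mul_assoc, ih]; ring

theorem qP_ne {F : Type*} [Field F] (q y : F) (h : ∀ j : ℕ, 1 - y * q ^ j ≠ 0) (k : ℕ) :
    qPoch q y k ≠ 0 := Finset.prod_ne_zero_iff.2 fun j _ => h j

theorem qP_van {F : Type*} [Field F] (q : F) (hq : q ≠ 0) (n k : ℕ) (h : n < k) :
    qPoch q ((q ^ n)⁻¹) k = 0 := by
  apply Finset.prod_eq_zero (Finset.mem_range.2 h)
  rw [inv_mul_cancel₀ (pow_ne_zero _ hq), sub_self]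

/-- `(q^{-n})_k` from `(q^{-n-1})_k`. -/
theorem qP_down {F : Type*} [Field F] (q : F) (hq : q ≠ 0) (h1 : ∀ j : ℕ, 1 - q * q ^ j ≠ 0)
    (n k : ℕ) : qPoch q ((q ^ n)⁻¹) k =
      qPoch q ((q ^ (n + 1))⁻¹) k * (q ^ n * q - q ^ k) / (q ^ n * q - 1) := by
  have h := qP_shift q ((q ^ (n + 1))⁻¹) k
  have e : (q ^ (n + 1))⁻¹ * q = (q ^ n)⁻¹ := by
    rw [pow_succ]; field_simp
  rw [e] at h
  have h2 : q ^ n * q - 1 ≠ 0 := by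
    have := h1 n
    contrapose! this
    linear_combination -this
  have h3 : q ^ n ≠ 0 := pow_ne_zero _ hq
  rw [eq_div_iff h2]
  rw [pow_succ] at h ⊢
  generalize qPoch q ((q ^ n)⁻¹) k = A at *
  generalize qPoch q ((q ^ n * q)⁻¹) k = B at *
  field_simp at h
  linear_combination h

theorem qP_cdown {F : Type*} [Field F] (q c : F) (hc : ∀ j : ℕ, 1 - c * q ^ j ≠ 0)
    (n k : ℕ) : qPoch q (c * q ^ n) k =
      qPoch q (c * q ^ (n + 1)) k * (1 - c * q ^ n) / (1 - c * q ^ n * q ^ k) := by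
  have h := qP_shift q (c * q ^ n) k
  have h2 : 1 - c * q ^ n * q ^ k ≠ 0 := by
    have := hc (n + k); rwa [pow_add, ← mul_assoc] at this
  rw [eq_div_iff h2, ← h, pow_succ]; ring_nf

noncomputable def fM {F : Type*} [Field F] (q a c x : F) (M n : ℕ) : F :=
  ∑ k ∈ Finset.range M, qPoch q ((q ^ n)⁻¹) k * qPoch q a k * qPoch q x k * q ^ k /
          (qPoch q q k * qPoch q c k)

noncomputable def Ck {F : Type*} [Field F] (q a c x : F) (k : ℕ) : F :=
  qPoch q a k * qPoch q (c / a) k * qPoch q x k * qPoch q (c / x) k /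
    (qPoch q q k * qPoch q c k * qPoch q c (2 * k))

noncomputable def SM {F : Type*} [Field F] (q a c x : F) (M n : ℕ) : F :=
  a ^ n * ∑ k ∈ Finset.range M, qPoch q ((q ^ n)⁻¹) k * qPoch q (c * q ^ n) k * q ^ k * Ck q a c x k

noncomputable def TM {F : Type*} [Field F] (q a c x : F) (M n : ℕ) : F :=
  a ^ n * ∑ k ∈ Finset.range M, qPoch q ((q ^ n)⁻¹) k * qPoch q (c * q ^ (n + 1)) k * q ^ k *
    Ck q a c x k * ((a - c * q ^ k) + x * (1 - a * q ^ k)) / (1 - c * q ^ k * q ^ k)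

theorem tele {F : Type*} [Field F] (R G : ℕ → F) (h : ∀ k, R k = G (k + 1) - G k) (M : ℕ)
    (h0 : G 0 = 0) (hM : G M = 0) : ∑ k ∈ Finset.range M, R k = 0 := by
  rw [Finset.sum_congr rfl fun k _ => h k, Finset.sum_range_sub, h0, hM, sub_zero]

theorem f_rec {F : Type*} [Field F] (q a c x : F) (hq : q ≠ 0)
    (h1 : ∀ j : ℕ, 1 - q * q ^ j ≠ 0) (hc : ∀ j : ℕ, 1 - c * q ^ j ≠ 0) (M n : ℕ)
    (hM : n + 2 < M) :
    (1 - c * q ^ (n + 1)) * fM q a c x M (n + 2) =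
      ((a - c * q ^ (n + 1)) + x * (1 - a * q ^ (n + 1))) * fM q a c x M (n + 1)
      - a * x * (1 - q ^ (n + 1)) * fM q a c x M n := by
  rw [← sub_eq_zero]
  unfold fM
  simp only [Finset.mul_sum, ← Finset.sum_sub_distrib]
  refine tele _ (fun k => - qPoch q a k * qPoch q x k * qPoch q ((q ^ (n + 2))⁻¹) k *
    (1 - q ^ k) * (1 - c * q ^ k / q) * (q ^ (n + 2)) / ((1 - q ^ (n + 2)) *
      (qPoch q q k * qPoch q c k))) ?_ M (by simp) (by simp [qP_van q hq _ _ hM])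
  intro k
  have hA := qP_ne q q h1 k
  have hB := qP_ne q c hc k
  have e1 := h1 k
  have e2 := hc k
  have e3 := h1 n
  have e4 := h1 (n + 1)
  have e5 : q ^ n ≠ 0 := pow_ne_zero _ hq
  rw [qP_down q hq h1 n, qP_down q hq h1 (n + 1)]
  simp only [qP_succ, show n + 1 + 1 = n + 2 from rfl]
  generalize qPoch q ((q ^ (n + 2))⁻¹) k = A at *
  generalize qPoch q q k = B at *
  generalize qPoch q c k = C at *
  generalize qPoch q a k = D at *
  generalize qPoch q x k = E at *
  simp only [pow_succ] at *
  generalize q ^ n = Y at *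
  generalize q ^ k = K at *
  have e3' : Y * q - 1 ≠ 0 := by contrapose! e3; linear_combination -e3
  have e4' : Y * q * q - 1 ≠ 0 := by contrapose! e4; linear_combination -e4
  have e4'' : 1 - Y * q * q ≠ 0 := by contrapose! e4; linear_combination e4
  have e4a : Y * q ^ 2 - 1 ≠ 0 := by contrapose! e4; linear_combination -e4
  have e4b : q ^ 2 * Y - 1 ≠ 0 := by contrapose! e4; linear_combination -e4
  have e4c : 1 - Y * q ^ 2 ≠ 0 := by contrapose! e4; linear_combination e4
  have e4d : 1 - q ^ 2 * Y ≠ 0 := by contrapose! e4; linear_combination e4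
  field_simp
  ring

theorem T_rec {F : Type*} [Field F] (q a c x : F) (hq : q ≠ 0) (hx : x ≠ 0) (hc0 : c ≠ 0)
    (h1 : ∀ j : ℕ, 1 - q * q ^ j ≠ 0) (hc : ∀ j : ℕ, 1 - c * q ^ j ≠ 0) (M n : ℕ) :
    (1 - c * q ^ (n + 1)) * TM q a c x M (n + 1) =
      ((a - c * q ^ (n + 1)) + x * (1 - a * q ^ (n + 1))) * SM q a c x M (n + 1)
      - a * x * (1 - q ^ (n + 1)) * TM q a c (c / x) M n := by
  unfold TM SM
  simp only [Finset.mul_sum, ← Finset.sum_sub_distrib]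
  refine Finset.sum_congr rfl fun k _ => ?_
  have hC : Ck q a c (c / x) k = Ck q a c x k := by
    unfold Ck
    rw [div_div_cancel₀ hc0]; ring
  rw [hC, qP_down q hq h1 n, qP_cdown q c hc (n + 1)]
  have e3 := h1 n
  have e5 : q ^ n ≠ 0 := pow_ne_zero _ hq
  have e6 := hc (k + k)
  have e7 := hc (n + 1 + k)
  have e8 := hc (n + 1)
  generalize qPoch q ((q ^ (n + 1))⁻¹) k = A at *
  generalize qPoch q (c * q ^ (n + 1 + 1)) k = B at *
  generalize Ck q a c x k = C at *
  simp only [pow_succ, pow_add, pow_zero, one_mul] at *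
  generalize q ^ n = Y at *
  generalize q ^ k = K at *
  generalize a ^ n = L at *
  have e3' : Y * q - 1 ≠ 0 := by contrapose! e3; linear_combination -e3
  have e6' : 1 - c * K * K ≠ 0 := by rwa [mul_assoc]
  have e6a : 1 - c * K ^ 2 ≠ 0 := by contrapose! e6; linear_combination e6
  have e7' : 1 - c * (Y * q) * K ≠ 0 := by rwa [mul_assoc]
  have e7'' : 1 - c * Y * q * K ≠ 0 := by contrapose! e7; linear_combination e7
  field_simp
  ring

set_option maxHeartbeats 4000000 in
theorem S_rec {F : Type*} [Field F] (q a c x : F) (hq : q ≠ 0) (hx : x ≠ 0) (ha : a ≠ 0)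
    (h1 : ∀ j : ℕ, 1 - q * q ^ j ≠ 0) (hc : ∀ j : ℕ, 1 - c * q ^ j ≠ 0) (M n : ℕ)
    (hM : n + 2 < M) :
    (1 - c * q ^ (n + 1)) ^ 2 * SM q a c x M (n + 2) =
      (1 - c * q ^ (n + 1)) * ((a - c * q ^ (n + 1)) + c / x * (1 - a * q ^ (n + 1))) *
        TM q a c x M (n + 1)
      - a * (c / x) * (1 - q ^ (n + 1)) *
       (((a - c * q ^ (n + 1)) + x * (1 - a * q ^ (n + 1))) * TM q a c x M n
         - a * x * (1 - q ^ (n + 1)) * SM q a c x M n) := by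
  rw [← sub_eq_zero]
  unfold TM SM
  simp only [Finset.mul_sum, ← Finset.sum_sub_distrib]
  refine tele _ (fun k => -a ^ (n + 2) * qPoch q ((q ^ (n + 2))⁻¹) k *
    qPoch q (c * q ^ (n + 2)) k * Ck q a c x k * (1 - q ^ k) * (1 - c * q ^ k / q) *
    (1 - c * q ^ k * q ^ k / q) * (1 - c * q ^ (2 * n + 2)) * (1 - c * q ^ (n + 1)) * q ^ (n + 2)
    / ((1 - q ^ (n + 2)) * (1 - c * q ^ n * q ^ k) * (1 - c * q ^ (n + 1) * q ^ k)))
     ?_ M (by simp) (by simp [qP_van q hq _ _ hM])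
  intro k
  have hA := qP_ne q q h1 k
  have hB := qP_ne q c hc k
  have hC := qP_ne q c hc (2 * k)
  rw [qP_down q hq h1 n, qP_down q hq h1 (n + 1), qP_cdown q c hc n, qP_cdown q c hc (n + 1)]
  have e1 := h1 k
  have e2 := hc k
  have e3 := h1 n
  have e4 := h1 (n + 1)
  have e5 : q ^ n ≠ 0 := pow_ne_zero _ hq
  have e6 := hc (k + k)
  have e7 := hc (n + 1 + k)
  have e8 := hc (n + 1)
  have e9 := hc (n + k)
  have e10 := hc (k + k + 1)
  have e11 := hc n
  have e12 := hc (n + k + 2)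
  simp only [Ck, qP_succ, show n + 1 + 1 = n + 2 from rfl, show 2 * (k + 1) = 2 * k + 1 + 1 by ring,
    show 2 * n + 2 = n + n + 1 + 1 by ring]
  generalize qPoch q ((q ^ (n + 2))⁻¹) k = A at *
  generalize qPoch q (c * q ^ (n + 2)) k = B at *
  generalize qPoch q a k = C1 at *
  generalize qPoch q (c / a) k = C2 at *
  generalize qPoch q x k = C3 at *
  generalize qPoch q (c / x) k = C4 at *
  generalize qPoch q q k = C5 at *
  generalize qPoch q c k = C6 at *
  generalize qPoch q c (2 * k) = C7 at *
  simp only [two_mul, pow_succ, pow_add, pow_zero, one_mul] at *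
  generalize q ^ n = Y at *
  generalize q ^ k = K at *
  generalize a ^ n = L at *
  have e3' : Y * q - 1 ≠ 0 := by contrapose! e3; linear_combination -e3
  have e4' : Y * q * q - 1 ≠ 0 := by contrapose! e4; linear_combination -e4
  have e4'' : 1 - Y * q * q ≠ 0 := by contrapose! e4; linear_combination e4
  have e4a : Y * q ^ 2 - 1 ≠ 0 := by contrapose! e4; linear_combination -e4
  have e4b : q ^ 2 * Y - 1 ≠ 0 := by contrapose! e4; linear_combination -e4
  have e4c : 1 - Y * q ^ 2 ≠ 0 := by contrapose! e4; linear_combination e4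
  have e4d : 1 - q ^ 2 * Y ≠ 0 := by contrapose! e4; linear_combination e4
  have e6' : 1 - c * K * K ≠ 0 := by rwa [mul_assoc]
  have e6a : 1 - c * K ^ 2 ≠ 0 := by contrapose! e6; linear_combination e6
  have e7' : 1 - c * (Y * q) * K ≠ 0 := by rwa [mul_assoc]
  have e9' : 1 - c * Y * K ≠ 0 := by rwa [mul_assoc]
  have e13 : 1 - c * (Y * q) * (K * q) ≠ 0 := by contrapose! e12; linear_combination e12
  have e14 : 1 - c * Y * (K * q) ≠ 0 := by contrapose! e7; linear_combination e7
  have e15 : 1 - c * (K * K) ≠ 0 := e6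
  have e16 : 1 - c * Y * q * K ≠ 0 := by contrapose! e7; linear_combination e7
  have e17 : 1 - c * Y * q ^ 2 * K ≠ 0 := by contrapose! e12; linear_combination e12
  have e18 : 1 - c * K ^ 2 ≠ 0 := by contrapose! e6; linear_combination e6
  have e19 : 1 - c * K ^ 2 * q ≠ 0 := by contrapose! e10; linear_combination e10
  have e20 : 1 - q ^ 2 * Y ≠ 0 := by contrapose! e4; linear_combination e4
  have e21 : 1 - c * q * K ^ 2 ≠ 0 := by contrapose! e10; linear_combination e10
  have core : K * ((1 - c * Y * q) * a * x * (Y * q ^ 2 - 1) * (1 - c * K ^ 2) * (Y * q - 1) * (1 - c * Y * q * K) *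
            (1 - c * Y * K) -
          (Y * q ^ 2 - K) *
            (((a - c * Y * q) * x + c * (1 - Y * q * a)) * (a - c * K + x * (1 - a * K)) * (Y * q - 1) *
                  (1 - c * Y * q * K) *
                (1 - c * Y * K) -
              c * (1 - Y * q) * (Y * q - K) *
                ((a - c * K + x * (1 - a * K)) * (a - c * Y * q + x * (1 - Y * q * a)) * (1 - c * Y * K) -
                  a * x * (1 - c * K ^ 2) * (1 - Y * q) * (1 - c * Y)))) =
      -(Y * q - 1) * (1 - c * Y ^ 2 * q ^ 2) *
      (-((Y * q ^ 2 - K) * (a - c * K) * (1 - a * K) * (1 - c * Y * K) * (1 - K * x) * (x - c * K)) -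
        -(Y * a * x * (1 - c * K ^ 2) * (1 - K) * (q - c * K) * (q - c * K ^ 2))) := by
    ring
  field_simp
  generalize ((1 - c * Y * q) * a * x * (Y * q ^ 2 - 1) * (1 - c * K ^ 2) * (Y * q - 1) * (1 - c * Y * q * K) *
            (1 - c * Y * K) -
          (Y * q ^ 2 - K) *
            (((a - c * Y * q) * x + c * (1 - Y * q * a)) * (a - c * K + x * (1 - a * K)) * (Y * q - 1) *
                  (1 - c * Y * q * K) *
                (1 - c * Y * K) -
              c * (1 - Y * q) * (Y * q - K) *
                ((a - c * K + x * (1 - a * K)) * (a - c * Y * q + x * (1 - Y * q * a)) * (1 - c * Y * K) -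
                  a * x * (1 - c * K ^ 2) * (1 - Y * q) * (1 - c * Y)))) = G at *
  generalize (-((Y * q ^ 2 - K) * (a - c * K) * (1 - a * K) * (1 - c * Y * K) * (1 - K * x) * (x - c * K)) -
        -(Y * a * x * (1 - c * K ^ 2) * (1 - K) * (q - c * K) * (q - c * K ^ 2))) = H at *
  linear_combination (1 - c * Y * q) * L * A * B * C1 * C2 * C3 * C4 * (1 - Y * q ^ 2) * core

theorem main_ind {F : Type*} [Field F] (q a c x : F) (hq : q ≠ 0) (hx : x ≠ 0) (ha : a ≠ 0)
    (hc0 : c ≠ 0) (h1 : ∀ j : ℕ, 1 - q * q ^ j ≠ 0) (hc : ∀ j : ℕ, 1 - c * q ^ j ≠ 0) (M n : ℕ)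
    (hM : n + 1 < M) :
    fM q a c x M n * fM q a c (c / x) M n = SM q a c x M n ∧
    fM q a c x M (n + 1) * fM q a c (c / x) M (n + 1) = SM q a c x M (n + 1) ∧
    fM q a c x M (n + 1) * fM q a c (c / x) M n = TM q a c x M n ∧
    fM q a c (c / x) M (n + 1) * fM q a c x M n = TM q a c (c / x) M n := by
  have hx' : c / x ≠ 0 := div_ne_zero hc0 hx
  have hxx : c / (c / x) = x := div_div_cancel₀ hc0
  induction n with
  | zero =>
    obtain ⟨m, rfl⟩ : ∃ m, M = m + 2 := ⟨M - 2, by omega⟩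
    have r0 : ∀ g : ℕ → F, (∀ k, 1 ≤ k → g k = 0) → ∑ k ∈ range (m + 2), g k = g 0 := by
      intro g hg
      rw [Finset.sum_eq_single 0]
      · intro b _ hb; exact hg b (by omega)
      · simp
    have r1 : ∀ g : ℕ → F, (∀ k, 2 ≤ k → g k = 0) → ∑ k ∈ range (m + 2), g k = g 0 + g 1 := by
      intro g hg
      rw [add_comm m 2, Finset.sum_range_add, Finset.sum_eq_zero (s := range m)]
      · simp [Finset.sum_range_succ]
      · intro b _; exact hg _ (by omega)
    have f0 : ∀ y, fM q a c y (m + 2) 0 = 1 := by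
      intro y
      unfold fM
      rw [r0 _ (fun k hk => by rw [qP_van q hq 0 k (by omega)]; simp)]
      simp [qP_zero]
    have p1 : ∀ y, qPoch q y 1 = 1 - y := by intro y; simp [qPoch]
    have e0 := h1 0
    have e1 := hc 0
    have e2 := hc 1
    simp only [pow_zero, pow_one, mul_one] at e0 e1 e2
    have f1 : ∀ y, fM q a c y (m + 2) 1 = 1 - (1 - a) * (1 - y) / (1 - c) := by
      intro y
      unfold fM
      rw [r1 _ (fun k hk => by rw [qP_van q hq 1 k (by omega)]; simp)]
      simp only [qP_zero, p1, pow_one, pow_zero]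
      field_simp
      ring
    have t0 : ∀ y, TM q a c y (m + 2) 0 = 1 - (1 - a) * (1 - y) / (1 - c) := by
      intro y
      unfold TM
      rw [r0 _ (fun k hk => by rw [qP_van q hq 0 k (by omega)]; simp)]
      simp only [qP_zero, p1, pow_one, pow_zero, Ck, mul_zero, mul_one]
      field_simp
      ring
    refine ⟨?_, ?_, ?_, ?_⟩
    · rw [f0, f0]
      unfold SM
      rw [r0 _ (fun k hk => by rw [qP_van q hq 0 k (by omega)]; simp)]
      simp [qP_zero, Ck]
    · simp only [zero_add]
      rw [f1, f1]
      unfold SM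
      rw [r1 _ (fun k hk => by rw [qP_van q hq 1 k (by omega)]; simp)]
      have p2 : ∀ y, qPoch q y 2 = (1 - y) * (1 - y * q) := by
        intro y; simp [qPoch, Finset.prod_range_succ]
      simp only [qP_zero, p1, p2, pow_one, pow_zero, Ck, mul_zero, mul_one]
      field_simp
      ring
    · rw [f0, zero_add, f1, t0, mul_one]
    · rw [f0, zero_add, f1, t0, mul_one]
  | succ n ih =>
    obtain ⟨i1, i2, i3, i4⟩ := ih (by omega)
    have ez := hc (n + 1)
    have R1 := f_rec q a c x hq h1 hc M n (by omega)
    have R2 := f_rec q a c (c / x) hq h1 hc M n (by omega)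
    have T1 := T_rec q a c x hq hx hc0 h1 hc M n
    have T2 := T_rec q a c (c / x) hq hx' hc0 h1 hc M n
    have hS : ∀ k, SM q a c (c / x) M k = SM q a c x M k := by
      intro k
      unfold SM Ck
      rw [hxx]
      congr 1
      refine Finset.sum_congr rfl fun k _ => ?_
      ring
    rw [hxx, hS] at T2
    have S1 := S_rec q a c x hq hx ha h1 hc M n (by omega)
    have j3 : fM q a c x M (n + 1 + 1) * fM q a c (c / x) M (n + 1) = TM q a c x M (n + 1) := by
      apply mul_left_cancel₀ ez
      rw [T1, ← i2, ← i4, ← mul_assoc, R1]; ring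
    have j4 : fM q a c (c / x) M (n + 1 + 1) * fM q a c x M (n + 1) =
        TM q a c (c / x) M (n + 1) := by
      apply mul_left_cancel₀ ez
      rw [T2, ← i2, ← i3, ← mul_assoc, R2]; ring
    refine ⟨i2, ?_, j3, j4⟩
    apply mul_left_cancel₀ (pow_ne_zero 2 ez)
    rw [S1, ← j3, ← i3, ← i1]
    linear_combination (1 - c * q ^ (n + 1)) * fM q a c x M (n + 2) * R2
      - a * (c / x) * (1 - q ^ (n + 1)) * fM q a c (c / x) M n * R1

theorem sum_trunc {F : Type*} [Field F] (q : F) (hq : q ≠ 0) (n : ℕ) (g : ℕ → F)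
    (hg : ∀ k, qPoch q ((q ^ n)⁻¹) k = 0 → g k = 0) :
    ∑ k ∈ range (n + 2), g k = ∑ k ∈ range (n + 1), g k := by
  rw [Finset.sum_range_succ, hg (n + 1) (qP_van q hq n (n + 1) (by omega)), add_zero]

theorem gen_CO {F : Type*} [Field F] (q a c x : F) (hq : q ≠ 0) (hx : x ≠ 0) (ha : a ≠ 0)
    (hc0 : c ≠ 0) (h1 : ∀ j : ℕ, 1 - q * q ^ j ≠ 0) (hc : ∀ j : ℕ, 1 - c * q ^ j ≠ 0) (n : ℕ) :
    (∑ k ∈ Finset.range (n + 1),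
        qPoch q ((q ^ n)⁻¹) k * qPoch q a k * qPoch q x k * q ^ k /
          (qPoch q q k * qPoch q c k)) *
      (∑ k ∈ Finset.range (n + 1),
        qPoch q ((q ^ n)⁻¹) k * qPoch q a k * qPoch q (c / x) k * q ^ k /
          (qPoch q q k * qPoch q c k)) =
    a ^ n * ∑ k ∈ Finset.range (n + 1),
        qPoch q ((q ^ n)⁻¹) k * qPoch q (c * q ^ n) k * qPoch q a k * qPoch q (c / a) k *
          qPoch q x k * qPoch q (c / x) k * q ^ k /
          (qPoch q q k * qPoch q c k * qPoch q c (2 * k)) := by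
  have h := (main_ind q a c x hq hx ha hc0 h1 hc (n + 2) n (by omega)).1
  unfold fM SM Ck at h
  rw [sum_trunc q hq n _ (fun k hk => by rw [hk]; simp),
    sum_trunc q hq n _ (fun k hk => by rw [hk]; simp),
    sum_trunc q hq n _ (fun k hk => by rw [hk]; simp)] at h
  rw [h]
  congr 1
  refine Finset.sum_congr rfl fun k _ => ?_
  ring

theorem algF4_ne (p r : MvPolynomial (Fin 4) ℚ) (v : Fin 4 → ℚ)
    (h : MvPolynomial.eval v p ≠ MvPolynomial.eval v r) :
    algebraMap (MvPolynomial (Fin 4) ℚ) F4 p ≠ algebraMap (MvPolynomial (Fin 4) ℚ) F4 r := by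
  intro e
  exact h (by rw [IsFractionRing.injective (MvPolynomial (Fin 4) ℚ) F4 e])

theorem X_F4_ne (i : Fin 4) :
    algebraMap (MvPolynomial (Fin 4) ℚ) F4 (MvPolynomial.X i) ≠ 0 := by
  have := algF4_ne (MvPolynomial.X i) 0 (fun _ => 1) (by simp)
  simpa using this

theorem XX_F4_ne (i : Fin 4) (j : ℕ) :
    1 - algebraMap (MvPolynomial (Fin 4) ℚ) F4 (MvPolynomial.X i) *
      algebraMap (MvPolynomial (Fin 4) ℚ) F4 (MvPolynomial.X 0) ^ j ≠ 0 := by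
  have := algF4_ne 1 (MvPolynomial.X i * MvPolynomial.X 0 ^ j) (fun _ => 0) (by simp)
  rw [map_one, map_mul, map_pow] at this
  exact sub_ne_zero.2 this

theorem q_Clausen_Orr (n : ℕ) :
    (∑ k ∈ Finset.range (n + 1),
        qPoch q ((q ^ n)⁻¹) k * qPoch q a k * qPoch q x k * q ^ k /
          (qPoch q q k * qPoch q c k)) *
      (∑ k ∈ Finset.range (n + 1),
        qPoch q ((q ^ n)⁻¹) k * qPoch q a k * qPoch q (c / x) k * q ^ k /
          (qPoch q q k * qPoch q c k)) =
    a ^ n * ∑ k ∈ Finset.range (n + 1),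
        qPoch q ((q ^ n)⁻¹) k * qPoch q (c * q ^ n) k * qPoch q a k * qPoch q (c / a) k *
          qPoch q x k * qPoch q (c / x) k * q ^ k /
          (qPoch q q k * qPoch q c k * qPoch q c (2 * k)) := by
  exact gen_CO q a c x (X_F4_ne 0) (X_F4_ne 3) (X_F4_ne 1) (X_F4_ne 2) (XX_F4_ne 0) (XX_F4_ne 2) n
end

section
/- Let n and r be positive integers, and for k ≥ 0 define S_k(x_0,…,x_k;q) = ∑_{i=0}^{k} [k+i choose 2i]_q [2i choose i]_q q^{-ki} x_i. Then both ∑_{k=0}^{n-1} ((1-q^{2k+1})/(1-q^n)) S_k(x_0,…,x_k;q)^r q^{-k} and ∑_{k=0}^{n-1} (-1)^{n-k-1} ((1-q^{2k+1})/(1-q^n)) S_k(x_0,…,x_k;q)^r q^{k(k-1)/2} are polynomials in x_0, …, x_{n-1}, q, and q^{-1} with non-negative integer coefficients. -/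
open Finset

/-- The q-binomial coefficient `[n choose k]_q`, which is
`(q;q)_n / ((q;q)_k (q;q)_{n-k})` for `0 ≤ k ≤ n` and `0` otherwise. -/
noncomputable def qBin {F : Type*} [Field F] (q : F) (n k : ℕ) : F :=
  if k ≤ n then qPoch q q n / (qPoch q q k * qPoch q q (n - k)) else 0

/-- The field of rational functions `ℚ(q, x_0, …, x_{n-1})`. -/
abbrev Fn (n : ℕ) : Type := FractionRing (MvPolynomial (Option (Fin n)) ℚ)

noncomputable def qv (n : ℕ) : Fn n :=
  algebraMap (MvPolynomial (Option (Fin n)) ℚ) (Fn n) (MvPolynomial.X none)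

noncomputable def xv (n : ℕ) (i : Fin n) : Fn n :=
  algebraMap (MvPolynomial (Option (Fin n)) ℚ) (Fn n) (MvPolynomial.X (some i))

/-- `S_k(x_0, …, x_k; q) = ∑_{i=0}^{k} [k+i choose 2i]_q [2i choose i]_q q^{-ki} x_i`. -/
noncomputable def S {F : Type*} [Field F] {n : ℕ} (q : F) (x : Fin n → F) (k : Fin n) : F :=
  ∑ i : Fin ((k : ℕ) + 1),
    qBin q ((k : ℕ) + i) (2 * i) * qBin q (2 * i) i * (q ^ ((k : ℕ) * i))⁻¹ *
      x (Fin.castLE k.isLt i)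


section helpers
variable {F : Type*} [Field F]

lemma hQ_succ (q : F) (n : ℕ) : qPoch q q (n+1) = qPoch q q n * (1 - q^(n+1)) := by
  unfold qPoch
  rw [Finset.prod_range_succ, pow_succ' q n]

lemma hQ_zero (q : F) : qPoch q q 0 = 1 := by simp [qPoch]

lemma hQ_ne (q : F) (h : ∀ m : ℕ, 1 - q^(m+1) ≠ 0) (n : ℕ) : qPoch q q n ≠ 0 := by
  induction n with
  | zero => simp [hQ_zero]
  | succ n ih => rw [hQ_succ]; exact mul_ne_zero ih (h n)

lemma hBin_add (q : F) (a b : ℕ) :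
    qBin q (a+b) a = qPoch q q (a+b) / (qPoch q q a * qPoch q q b) := by
  simp [qBin]

lemma hBin_mem (q : F) (h : ∀ m : ℕ, 1 - q^(m+1) ≠ 0) (N : Subsemiring F) (hq : q ∈ N)
    (n k : ℕ) : qBin q n k ∈ N := by
  have hz : ∀ n, qBin q n 0 = 1 := fun n => by
    have := hBin_add q 0 n
    rw [zero_add] at this
    rw [this, hQ_zero, one_mul, div_self (hQ_ne q h n)]
  induction n generalizing k with
  | zero =>
    cases k with
    | zero => rw [hz]; exact N.one_mem
    | succ k => simp [qBin]
  | succ n ih =>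
    cases k with
    | zero => rw [hz]; exact N.one_mem
    | succ k =>
      by_cases hk : k + 1 ≤ n
      · obtain ⟨d, rfl⟩ := Nat.exists_eq_add_of_le hk
        have e : qBin q (k+1+d+1) (k+1) = qBin q (k+1+d) k + q^(k+1) * qBin q (k+1+d) (k+1) := by
          rw [hBin_add q (k+1) d, show k+1+d+1 = k+1+(d+1) by ring, hBin_add q (k+1) (d+1),
            show k+1+d = k+(d+1) by ring, hBin_add q k (d+1),
            show k+1+(d+1) = (k+(d+1))+1 by ring, hQ_succ q (k+(d+1)), hQ_succ q k, hQ_succ q d]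
          have h1 := hQ_ne q h k
          have h2 := hQ_ne q h d
          have h3 := h k
          have h4 := h d
          field_simp
          ring
        rw [e]
        exact N.add_mem (ih _) (N.mul_mem (N.pow_mem hq _) (ih _))
      · by_cases hk2 : k = n
        · subst hk2
          have := hBin_add q (k+1) 0
          rw [add_zero, hQ_zero, mul_one, div_self (hQ_ne q h _)] at this
          rw [this]; exact N.one_mem
        · have : ¬ (k + 1 ≤ n + 1) := by omega
          simp [qBin, this]

/-- unnormalised basis -/
noncomputable def tt (q : F) (s k : ℕ) : F :=
  ∏ j ∈ Finset.range s, ((q^k)⁻¹ + q^(k+1) - (q^(j+1) + (q^j)⁻¹))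

noncomputable def TT (q : F) (s k : ℕ) : F := tt q s k / (qPoch q q s)^2

lemma tt_succ (q : F) (s k : ℕ) :
    tt q (s+1) k = tt q s k * ((q^k)⁻¹ + q^(k+1) - (q^(s+1) + (q^s)⁻¹)) := by
  unfold tt
  rw [Finset.prod_range_succ]

lemma tt_zero (q : F) (k : ℕ) : tt q 0 k = 1 := by simp [tt]

lemma tt_vanish (q : F) (s k : ℕ) (h : k < s) : tt q s k = 0 := by
  unfold tt
  apply Finset.prod_eq_zero (Finset.mem_range.mpr h)
  ring

lemma TT_vanish (q : F) (s k : ℕ) (h : k < s) : TT q s k = 0 := by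
  simp [TT, tt_vanish q s k h]

lemma tt_closed (q : F) (hq0 : q ≠ 0) (s : ℕ) : ∀ d k : ℕ, s + d = k →
    tt q s k * qPoch q q d * q^(k*s) = qPoch q q (k+s) := by
  induction s with
  | zero => intro d k h; simp at h; subst h; simp [tt_zero]
  | succ s ih =>
    intro d k h
    have h1 := ih (d+1) k (by omega)
    rw [show k + (s+1) = k+s+1 by ring, hQ_succ q (k+s), ← h1, hQ_succ q d, tt_succ]
    subst h
    field_simp
    ring

lemma TT_eq (q : F) (hq0 : q ≠ 0) (h : ∀ m : ℕ, 1 - q^(m+1) ≠ 0) (s k : ℕ) (hs : s ≤ k) :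
    qBin q (k+s) (2*s) * qBin q (2*s) s * (q^(k*s))⁻¹ = TT q s k := by
  obtain ⟨d, rfl⟩ := Nat.exists_eq_add_of_le hs
  have h1 := tt_closed q hq0 s d (s+d) rfl
  have e1 : s + d + s = 2*s+d := by ring
  rw [e1, hBin_add q (2*s) d, ← e1, ← h1, show 2*s = s+s by ring, hBin_add q s s, TT]
  have h2 := hQ_ne q h s
  have h3 := hQ_ne q h d
  have h4 := hQ_ne q h (s+s)
  field_simp

lemma tt_shift (q : F) (hq0 : q ≠ 0) (s n : ℕ) :
    tt q s (n+1) * (q^s - q^(n+1)) = tt q s n * (1 - q^(n+1+s)) := by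
  induction s with
  | zero => simp [tt_zero]
  | succ s ih =>
    rw [tt_succ, tt_succ]
    have e1 : (q^(n+1))⁻¹ + q^(n+1+1) - (q^(s+1) + (q^s)⁻¹)
      = (q^(n+1+s))⁻¹ * (1 - q^(n+s+2)) * (q^s - q^(n+1)) := by
      field_simp; ring
    rw [e1]
    calc _ = (tt q s (n+1) * (q^s - q^(n+1))) * ((q^(n+1+s))⁻¹ * (1 - q^(n+s+2)) * (q^(s+1) - q^(n+1))) := by ring
      _ = _ := by
        rw [ih]
        field_simp
        ring

lemma sumA (q : F) (hq0 : q ≠ 0) (s n : ℕ) :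
    (∑ k ∈ Finset.range n, (1 - q^(2*k+1)) * (q^k)⁻¹ * tt q s k) * (1 - q^(s+1)) * q^n
      = (1 - q^n) * tt q s n * (q^(s+1) - q^(n+1)) := by
  induction n with
  | zero => simp
  | succ n ih =>
    rw [Finset.sum_range_succ, add_mul, add_mul, pow_succ q n]
    have h := tt_shift q hq0 s n
    have : (1 - q^n*q) * tt q s (n+1) * (q^(s+1) - q^(n+1+1))
      = (1 - q^n*q) * q * (tt q s n * (1 - q^(n+1+s))) := by rw [← h]; ring
    rw [this]
    have e2 : (∑ k ∈ Finset.range n, (1 - q^(2*k+1)) * (q^k)⁻¹ * tt q s k) * (1 - q^(s+1)) * (q^n*q)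
      = ((1 - q^n) * tt q s n * (q^(s+1) - q^(n+1))) * q := by rw [← ih]; ring
    rw [e2]
    field_simp
    ring

lemma sumB (q : F) (hq0 : q ≠ 0) (s n : ℕ) :
    (∑ k ∈ Finset.range n, (-1)^k * (1 - q^(2*k+1)) * q^(k*(k-1)/2) * tt q s k) * q^s
      = - (-1)^n * q^(n*(n-1)/2) * tt q s n * (q^s - q^n) := by
  induction n with
  | zero => cases s with
    | zero => simp
    | succ s => simp [tt_vanish q (s+1) 0 (by omega)]
  | succ n ih =>
    rw [Finset.sum_range_succ, add_mul, ih]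
    have h := tt_shift q hq0 s n
    have e : (n+1)*(n+1-1)/2 = n*(n-1)/2 + n := by
      rw [← Finset.sum_range_id_mul_two, ← Finset.sum_range_id_mul_two, Finset.sum_range_succ]
      simp
    rw [e, mul_assoc _ (tt q s (n+1)), h]
    ring

lemma mulcoef (q : F) (hq0 : q ≠ 0) (h : ∀ m : ℕ, 1 - q^(m+1) ≠ 0) (i j k : ℕ) (hij : j ≤ i) :
    TT q i k * TT q j k = ∑ m ∈ Finset.range (j+1),
      qBin q (i+j) i * qBin q j m * qBin q (i+m) j * (q^((i+m)*(j-m)))⁻¹ * TT q (i+m) k := by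
  induction j with
  | zero =>
    have h1 := hQ_ne q h i
    have e1 := hBin_add q i 0
    have e2 := hBin_add q 0 0
    have e3 := hBin_add q 0 i
    simp [hQ_zero, h1] at e1 e2 e3
    simp [TT, tt_zero, hQ_zero, e1, e2, e3]
  | succ j ih =>
    have ih := ih (by omega)
    obtain ⟨d, rfl⟩ := Nat.exists_eq_add_of_le hij
    set i := j+1+d with hi
    have step : TT q i k * TT q (j+1) k = (TT q i k * TT q j k) *
        ((q^k)⁻¹ + q^(k+1) - (q^(j+1) + (q^j)⁻¹)) / (1 - q^(j+1))^2 := by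
      have h1 := hQ_ne q h j
      have h2 := h j
      simp only [TT, tt_succ, hQ_succ]
      field_simp
    have tstep : ∀ s, TT q s k * ((q^k)⁻¹ + q^(k+1) - (q^(j+1) + (q^j)⁻¹)) / (1 - q^(j+1))^2
        = (1 - q^(s+1))^2 / (1 - q^(j+1))^2 * TT q (s+1) k
          + (q^(s+1) + (q^s)⁻¹ - (q^(j+1) + (q^j)⁻¹)) / (1 - q^(j+1))^2 * TT q s k := by
      intro s
      have h1 := hQ_ne q h s
      have h2 := h j
      have h3 := h s
      simp only [TT, tt_succ, hQ_succ]
      field_simp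
      ring
    rw [step, ih, Finset.sum_mul, Finset.sum_div]
    have hsplit : ∀ m, qBin q (i+j) i * qBin q j m * qBin q (i+m) j * (q^((i+m)*(j-m)))⁻¹ * TT q (i+m) k
        * ((q^k)⁻¹ + q^(k+1) - (q^(j+1) + (q^j)⁻¹)) / (1 - q^(j+1))^2
        = qBin q (i+j) i * qBin q j m * qBin q (i+m) j * (q^((i+m)*(j-m)))⁻¹ *
            ((1 - q^(i+m+1))^2 / (1 - q^(j+1))^2) * TT q (i+(m+1)) k
          + qBin q (i+j) i * qBin q j m * qBin q (i+m) j * (q^((i+m)*(j-m)))⁻¹ *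
            ((q^(i+m+1) + (q^(i+m))⁻¹ - (q^(j+1) + (q^j)⁻¹)) / (1 - q^(j+1))^2) * TT q (i+m) k := by
      intro m
      rw [mul_assoc _ (TT q (i+m) k), mul_div_assoc, tstep (i+m)]
      ring
    rw [Finset.sum_congr rfl (fun m _ => hsplit m), Finset.sum_add_distrib]
    rw [Finset.sum_range_succ, Finset.sum_range_succ' _ j, Finset.sum_range_succ _ (j+1),
      Finset.sum_range_succ' _ j]
    have hmid : ∀ m ∈ Finset.range j,
        qBin q (i+(j+1)) i * qBin q (j+1) (m+1) * qBin q (i+(m+1)) (j+1) *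
          (q^((i+(m+1))*(j+1-(m+1))))⁻¹ * TT q (i+(m+1)) k
        = qBin q (i+j) i * qBin q j m * qBin q (i+m) j * (q^((i+m)*(j-m)))⁻¹ *
            ((1 - q^(i+m+1))^2 / (1 - q^(j+1))^2) * TT q (i+(m+1)) k
          + qBin q (i+j) i * qBin q j (m+1) * qBin q (i+(m+1)) j * (q^((i+(m+1))*(j-(m+1))))⁻¹ *
            ((q^(i+(m+1)+1) + (q^(i+(m+1)))⁻¹ - (q^(j+1) + (q^j)⁻¹)) / (1 - q^(j+1))^2)
              * TT q (i+(m+1)) k := by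
      intro m hm
      obtain ⟨p, hp⟩ := Nat.exists_eq_add_of_lt (Finset.mem_range.mp hm)
      rw [← add_mul]
      congr 1
      have b1 : qBin q (i+(j+1)) i = qPoch q q (i+j) * (1 - q^(i+j+1)) /
          (qPoch q q i * (qPoch q q j * (1 - q^(j+1)))) := by
        rw [hBin_add, ← add_assoc, hQ_succ, hQ_succ]
      have b2 : qBin q (j+1) (m+1) = qPoch q q j * (1 - q^(j+1)) /
          (qPoch q q m * (1 - q^(m+1)) * (qPoch q q p * (1 - q^(p+1)))) := by
        rw [show j+1 = m+1+(p+1) by omega, hBin_add, hQ_succ q m, hQ_succ q p,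
          show m+1+(p+1) = j+1 by omega, hQ_succ]
      have b3 : qBin q (i+(m+1)) (j+1) = qPoch q q (i+m) * (1 - q^(i+m+1)) /
          (qPoch q q j * (1 - q^(j+1)) * (qPoch q q (d+m) * (1 - q^(d+m+1)))) := by
        rw [show i+(m+1) = j+1+(d+m+1) by omega, hBin_add, hQ_succ q j, hQ_succ q (d+m),
          show j+1+(d+m+1) = i+m+1 by omega, hQ_succ]
      have b4 : qBin q j m = qPoch q q j / (qPoch q q m * (qPoch q q p * (1 - q^(p+1)))) := by
        rw [show j = m+(p+1) by omega, hBin_add, hQ_succ q p]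
      have b5 : qBin q j (m+1) = qPoch q q j / (qPoch q q m * (1 - q^(m+1)) * qPoch q q p) := by
        rw [show j = (m+1)+p by omega, hBin_add, hQ_succ q m]
      have b6 : qBin q (i+m) j = qPoch q q (i+m) / (qPoch q q j * (qPoch q q (d+m) * (1 - q^(d+m+1)))) := by
        rw [show i+m = j+(d+m+1) by omega, hBin_add, hQ_succ q (d+m)]
      have b7 : qBin q (i+(m+1)) j = qPoch q q (i+m) * (1 - q^(i+m+1)) /
          (qPoch q q j * (qPoch q q (d+m) * (1 - q^(d+m+1)) * (1 - q^(d+m+2)))) := by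
        rw [show i+(m+1) = j+(d+m+1+1) by omega, hBin_add, hQ_succ q (d+m+1), hQ_succ q (d+m),
          show j+(d+m+1+1) = i+m+1 by omega, hQ_succ]
      have b8 : q^(i+(m+1)+1) + (q^(i+(m+1)))⁻¹ - (q^(j+1) + (q^j)⁻¹)
          = (q^(i+m+1))⁻¹ * (1 - q^(d+m+2)) * (1 - q^(i+m+j+2)) := by
        rw [hi]; field_simp; ring
      have c1 : (q^((i+(m+1))*(j+1-(m+1))))⁻¹ = (q^((i+m+1)*p))⁻¹ * (q^(i+m+1))⁻¹ := by
        rw [← mul_inv, ← pow_add]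
        congr 2
        rw [show j+1-(m+1) = p+1 by omega]; ring
      have c2 : (q^((i+m)*(j-m)))⁻¹ = (q^((i+m+1)*p))⁻¹ * (q^(i+m+1))⁻¹ * q^(p+1) := by
        have : (i+m+1)*p + (i+m+1) = (i+m)*(j-m) + (p+1) := by
          rw [show j-m = p+1 by omega]; ring
        rw [← mul_inv, ← pow_add, this, pow_add]
        field_simp
      have c3 : (q^((i+(m+1))*(j-(m+1))))⁻¹ = (q^((i+m+1)*p))⁻¹ := by
        rw [show j-(m+1) = p by omega, ← add_assoc]
      rw [b1, b2, b3, b4, b5, b6, b7, b8, c1, c2, c3, hBin_add q i j]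
      clear step tstep hsplit b1 b2 b3 b4 b5 b6 b7 b8 c1 c2 c3
      have l0 : (q^((i+m+1)*p))⁻¹ ≠ 0 := inv_ne_zero (pow_ne_zero _ hq0)
      have l6 := h (i+m)
      generalize (q^((i+m+1)*p))⁻¹ = E at *
      have k1 := hQ_ne q h (i+j)
      have k2 := hQ_ne q h i
      have k3 := hQ_ne q h j
      have k4 := hQ_ne q h m
      have k5 := hQ_ne q h p
      have k6 := hQ_ne q h (i+m)
      have k7 := hQ_ne q h (d+m)
      have l1 := h j
      have l2 := h m
      have l3 := h p
      have l4 := h (d+m)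
      have l5 : 1 - q^(d+m+2) ≠ 0 := h (d+m+1)
      have key : (1 - q^(i+j+1)) * (1 - q^(j+1)) =
          q^(p+1) * (1 - q^(m+1)) * (1 - q^(i+m+1)) + (1 - q^(p+1)) * (1 - q^(i+m+j+2)) := by
        rw [hp]; ring
      generalize qPoch q q (i+j) = Q1 at *
      generalize qPoch q q i = Q2 at *
      generalize qPoch q q j = Q3 at *
      generalize qPoch q q m = Q4 at *
      generalize qPoch q q p = Q5 at *
      generalize qPoch q q (i+m) = Q6 at *
      generalize qPoch q q (d+m) = Q7 at *
      have k8 : (q^(i+m+1))⁻¹ ≠ 0 := inv_ne_zero (pow_ne_zero _ hq0)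
      generalize (q^(i+m+1))⁻¹ = E2 at *
      generalize 1 - q^(i+j+1) = A1 at *
      generalize 1 - q^(j+1) = A2 at *
      generalize 1 - q^(m+1) = A3 at *
      generalize 1 - q^(i+m+1) = A4 at *
      generalize 1 - q^(p+1) = A5 at *
      generalize 1 - q^(i+m+j+2) = A6 at *
      generalize 1 - q^(d+m+1) = A7 at *
      generalize 1 - q^(d+m+2) = A8 at *
      generalize q^(p+1) = A9 at *
      field_simp
      linear_combination key
    rw [Finset.sum_congr rfl hmid, Finset.sum_add_distrib]
    have hlo : qBin q (i+(j+1)) i * qBin q (j+1) 0 * qBin q (i+0) (j+1) *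
          (q^((i+0)*(j+1-0)))⁻¹ 
        = qBin q (i+j) i * qBin q j 0 * qBin q (i+0) j * (q^((i+0)*(j-0)))⁻¹ *
            ((q^(i+0+1) + (q^(i+0))⁻¹ - (q^(j+1) + (q^j)⁻¹)) / (1 - q^(j+1))^2) := by
      have b1 : qBin q (i+(j+1)) i = qPoch q q (i+j) * (1 - q^(i+j+1)) /
          (qPoch q q i * (qPoch q q j * (1 - q^(j+1)))) := by
        rw [hBin_add, ← add_assoc, hQ_succ, hQ_succ]
      have b2 : ∀ n, qBin q n 0 = 1 := fun n => by
        have := hBin_add q 0 n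
        rw [zero_add] at this
        rw [this, hQ_zero, one_mul, div_self (hQ_ne q h n)]
      have b3 : qBin q i (j+1) = qPoch q q i / (qPoch q q j * (1 - q^(j+1)) * qPoch q q d) := by
        rw [hi, hBin_add, hQ_succ q j]
      have b4 : qBin q i j = qPoch q q i / (qPoch q q j * (qPoch q q d * (1 - q^(d+1)))) := by
        rw [show i = j+(d+1) by omega, hBin_add, hQ_succ q d]
      have b8 : q^(i+1) + (q^i)⁻¹ - (q^(j+1) + (q^j)⁻¹)
          = (q^i)⁻¹ * (1 - q^(d+1)) * (1 - q^(i+j+1)) := by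
        rw [hi]; field_simp; ring
      have c1 : (q^(i*(j+1)))⁻¹ = (q^(i*j))⁻¹ * (q^i)⁻¹ := by
        rw [← mul_inv, ← pow_add]; rfl
      simp only [add_zero, Nat.sub_zero]
      rw [b1, b2, b2, b3, b4, b8, c1, hBin_add]
      have k2 := hQ_ne q h i
      have k3 := hQ_ne q h j
      have k7 := hQ_ne q h d
      have l1 := h j
      have l4 := h d
      field_simp
    have hhi : qBin q (i+(j+1)) i * qBin q (j+1) (j+1) * qBin q (i+(j+1)) (j+1) *
          (q^((i+(j+1))*(j+1-(j+1))))⁻¹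
        = qBin q (i+j) i * qBin q j j * qBin q (i+j) j * (q^((i+j)*(j-j)))⁻¹ *
            ((1 - q^(i+j+1))^2 / (1 - q^(j+1))^2) := by
      have b1 : qBin q (i+(j+1)) i = qPoch q q (i+j) * (1 - q^(i+j+1)) /
          (qPoch q q i * (qPoch q q j * (1 - q^(j+1)))) := by
        rw [hBin_add, ← add_assoc, hQ_succ, hQ_succ]
      have b2 : ∀ n, qBin q n n = 1 := fun n => by
        have := hBin_add q n 0
        rw [add_zero] at this
        rw [this, hQ_zero, mul_one, div_self (hQ_ne q h n)]
      have b3 : qBin q (i+(j+1)) (j+1) = qPoch q q (i+j) * (1 - q^(i+j+1)) /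
          (qPoch q q j * (1 - q^(j+1)) * qPoch q q i) := by
        rw [add_comm i, hBin_add, hQ_succ q j, show j+1+i = i+j+1 by ring, hQ_succ]
      have b4 : qBin q (i+j) j = qPoch q q (i+j) / (qPoch q q j * qPoch q q i) := by
        rw [add_comm i, hBin_add]
      rw [b1, b2, b2, b3, b4, hBin_add]
      have k2 := hQ_ne q h i
      have k3 := hQ_ne q h j
      have l1 := h j
      simp only [Nat.sub_self, mul_zero, pow_zero, inv_one]
      field_simp
    rw [hlo, hhi]
    ring

/-- generators -/
def TMod (q : F) (N : Subsemiring F) : AddSubmonoid (ℕ → F) :=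
  AddSubmonoid.closure {g | ∃ a ∈ N, ∃ s : ℕ, g = fun k => a * TT q s k}

lemma Mod_gen (q : F) (N : Subsemiring F) (a : F) (ha : a ∈ N) (s : ℕ) :
    (fun k => a * TT q s k) ∈ TMod q N := AddSubmonoid.subset_closure ⟨a, ha, s, rfl⟩

lemma Mod_TT (q : F) (hq0 : q ≠ 0) (h : ∀ m : ℕ, 1 - q^(m+1) ≠ 0) (N : Subsemiring F)
    (hq : q ∈ N) (hqi : q⁻¹ ∈ N) (a : F) (ha : a ∈ N) (i j : ℕ) (hij : j ≤ i) :
    (fun k => a * (TT q i k * TT q j k)) ∈ TMod q N := by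
  have : (fun k => a * (TT q i k * TT q j k)) = ∑ m ∈ Finset.range (j+1), (fun k =>
      (a * (qBin q (i+j) i * qBin q j m * qBin q (i+m) j * (q^((i+m)*(j-m)))⁻¹)) * TT q (i+m) k) := by
    funext k
    rw [Finset.sum_apply, mulcoef q hq0 h i j k hij, Finset.mul_sum]
    exact Finset.sum_congr rfl (fun m _ => by ring)
  rw [this]
  refine AddSubmonoid.sum_mem _ (fun m _ => Mod_gen q N _ ?_ _)
  have hb := hBin_mem q h N hq
  refine N.mul_mem ha (N.mul_mem (N.mul_mem (N.mul_mem (hb _ _) (hb _ _)) (hb _ _)) ?_)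
  rw [← inv_pow]
  exact N.pow_mem hqi _

lemma Mod_mul (q : F) (hq0 : q ≠ 0) (h : ∀ m : ℕ, 1 - q^(m+1) ≠ 0) (N : Subsemiring F)
    (hq : q ∈ N) (hqi : q⁻¹ ∈ N) (f g : ℕ → F) (hf : f ∈ TMod q N) (hg : g ∈ TMod q N) :
    f * g ∈ TMod q N := by
  induction hf using AddSubmonoid.closure_induction with
  | zero => rw [zero_mul]; exact zero_mem _
  | add x y _ _ hx hy => rw [add_mul]; exact add_mem hx hy
  | mem x hx =>
    obtain ⟨a, ha, s, rfl⟩ := hx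
    induction hg using AddSubmonoid.closure_induction with
    | zero => rw [mul_zero]; exact zero_mem _
    | add x y _ _ hx hy => rw [mul_add]; exact add_mem hx hy
    | mem y hy =>
      obtain ⟨b, hb, t, rfl⟩ := hy
      rcases le_total t s with hts | hts
      · convert Mod_TT q hq0 h N hq hqi (a*b) (N.mul_mem ha hb) s t hts using 1
        funext k; simp only [Pi.mul_apply]; ring
      · convert Mod_TT q hq0 h N hq hqi (a*b) (N.mul_mem ha hb) t s hts using 1
        funext k; simp only [Pi.mul_apply]; ring

lemma Mod_pow (q : F) (hq0 : q ≠ 0) (h : ∀ m : ℕ, 1 - q^(m+1) ≠ 0) (N : Subsemiring F)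
    (hq : q ∈ N) (hqi : q⁻¹ ∈ N) (f : ℕ → F) (hf : f ∈ TMod q N) (r : ℕ) :
    f ^ r ∈ TMod q N := by
  induction r with
  | zero =>
    convert Mod_gen q N 1 N.one_mem 0 using 1
    funext k; simp [TT, tt_zero, hQ_zero]
  | succ r ih => rw [pow_succ]; exact Mod_mul q hq0 h N hq hqi _ _ ih hf

lemma Mod_linear (q : F) (N : Subsemiring F) (n : ℕ) (w : ℕ → F)
    (hw : ∀ s < n, ∑ k ∈ Finset.range n, w k * TT q s k ∈ N) (f : ℕ → F) (hf : f ∈ TMod q N) :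
    ∑ k ∈ Finset.range n, w k * f k ∈ N := by
  induction hf using AddSubmonoid.closure_induction with
  | zero => simp
  | add x y _ _ hx hy =>
    simp only [Pi.add_apply, mul_add, Finset.sum_add_distrib]; exact N.add_mem hx hy
  | mem x hx =>
    obtain ⟨a, ha, s, rfl⟩ := hx
    by_cases hs : s < n
    · have := N.mul_mem ha (hw s hs)
      convert this using 1
      rw [Finset.mul_sum]
      exact Finset.sum_congr rfl (fun m _ => by ring)
    · rw [Finset.sum_eq_zero]
      · exact N.zero_mem
      · intro k hk
        show w k * (a * TT q s k) = 0
        rw [TT_vanish q s k (by have := Finset.mem_range.mp hk; omega)]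
        ring

lemma wA (q : F) (hq0 : q ≠ 0) (h : ∀ m : ℕ, 1 - q^(m+1) ≠ 0) (N : Subsemiring F)
    (hq : q ∈ N) (hqi : q⁻¹ ∈ N) (n s : ℕ) (hs : s < n) :
    ∑ k ∈ Finset.range n, ((1 - q^(2*k+1)) / (1 - q^n) * (q^k)⁻¹) * TT q s k ∈ N := by
  obtain ⟨d, rfl⟩ := Nat.exists_eq_add_of_lt hs
  have hA := sumA q hq0 s (s+d+1)
  have hc := tt_closed q hq0 s (d+1) (s+d+1) rfl
  have h0 : ∑ k ∈ Finset.range (s+d+1), ((1 - q^(2*k+1)) / (1 - q^(s+d+1)) * (q^k)⁻¹) * TT q s k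
     = (∑ k ∈ Finset.range (s+d+1), (1 - q^(2*k+1)) * (q^k)⁻¹ * tt q s k) /
        ((1 - q^(s+d+1)) * (qPoch q q s)^2) := by
    rw [Finset.sum_div]
    refine Finset.sum_congr rfl (fun k _ => ?_)
    rw [TT, div_mul_eq_mul_div, div_mul_div_comm]
  have : ∑ k ∈ Finset.range (s+d+1), ((1 - q^(2*k+1)) / (1 - q^(s+d+1)) * (q^k)⁻¹) * TT q s k
     = qBin q (s+(s+d+1)) s * qBin q (s+1+d) (s+1) * q⁻¹^((s+d)*(s+1)) := by
    rw [h0, hBin_add, hBin_add, show s+(s+d+1) = s+d+1+s by ring, ← hc, show s+1+d = s+d+1 by ring,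
      hQ_succ q s, hQ_succ q d]
    have k1 := hQ_ne q h s
    have k2 := hQ_ne q h d
    have k3 := hQ_ne q h (s+d+1)
    have k4 := h (s+d)
    have k5 := h s
    have hA2 : (∑ k ∈ Finset.range (s+d+1), (1 - q^(2*k+1)) * (q^k)⁻¹ * tt q s k)
      = (1 - q^(s+d+1)) * tt q s (s+d+1) * (q^(s+1) - q^(s+d+1+1)) / ((1 - q^(s+1)) * q^(s+d+1)) := by
      rw [eq_div_iff (mul_ne_zero k5 (pow_ne_zero _ hq0))]
      rw [← hA]; ring
    rw [hA2, inv_pow]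
    field_simp
    ring
  rw [this]
  have hb := hBin_mem q h N hq
  exact N.mul_mem (N.mul_mem (hb _ _) (hb _ _)) (N.pow_mem hqi _)

lemma wB (q : F) (hq0 : q ≠ 0) (h : ∀ m : ℕ, 1 - q^(m+1) ≠ 0) (N : Subsemiring F)
    (hq : q ∈ N) (hqi : q⁻¹ ∈ N) (n s : ℕ) (hs : s < n) :
    ∑ k ∈ Finset.range n, ((-1)^(n-k-1) * ((1 - q^(2*k+1)) / (1 - q^n)) * q^(k*(k-1)/2)) * TT q s k ∈ N := by
  obtain ⟨d, rfl⟩ := Nat.exists_eq_add_of_lt hs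
  have hA := sumB q hq0 s (s+d+1)
  have hc := tt_closed q hq0 s (d+1) (s+d+1) rfl
  have h0 : ∑ k ∈ Finset.range (s+d+1), ((-1)^(s+d+1-k-1) * ((1 - q^(2*k+1)) / (1 - q^(s+d+1))) * q^(k*(k-1)/2)) * TT q s k
     = (-1)^(s+d) * (∑ k ∈ Finset.range (s+d+1), (-1)^k * (1 - q^(2*k+1)) * q^(k*(k-1)/2) * tt q s k) /
        ((1 - q^(s+d+1)) * (qPoch q q s)^2) := by
    rw [Finset.mul_sum, Finset.sum_div]
    refine Finset.sum_congr rfl (fun k hk => ?_)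
    have hk := Finset.mem_range.mp hk
    have e : (-1 : F)^(s+d+1-k-1) = (-1)^(s+d) * (-1)^k := by
      obtain ⟨e, he⟩ := Nat.exists_eq_add_of_le (show k ≤ s+d by omega)
      rw [show s+d+1-k-1 = e by omega, he, pow_add, mul_right_comm, ← mul_pow]
      simp
    rw [TT, e]
    have k1 := hQ_ne q h s
    have k4 := h (s+d)
    field_simp
  have : ∑ k ∈ Finset.range (s+d+1), ((-1)^(s+d+1-k-1) * ((1 - q^(2*k+1)) / (1 - q^(s+d+1))) * q^(k*(k-1)/2)) * TT q s k
     = qBin q (s+(s+d+1)) s * qBin q (s+d) s * q^((s+d+1)*(s+d+1-1)/2) * q⁻¹^((s+d+1)*s) := by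
    rw [h0, hBin_add, hBin_add, show s+(s+d+1) = s+d+1+s by ring, ← hc,
      hQ_succ q d, hQ_succ q (s+d)]
    generalize q^((s+d+1)*(s+d+1-1)/2) = E at *
    have k1 := hQ_ne q h s
    have k2 := hQ_ne q h d
    have k3 := hQ_ne q h (s+d)
    have k4 := h (s+d)
    have sg : (-1:F)^(s+d) * (-1)^(s+d) = 1 := by rw [← mul_pow]; simp
    have hA2 : (-1)^(s+d) * (∑ k ∈ Finset.range (s+d+1), (-1)^k * (1 - q^(2*k+1)) * q^(k*(k-1)/2) * tt q s k)
      = E * tt q s (s+d+1) * (1 - q^(d+1)) := by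
      apply mul_right_cancel₀ (pow_ne_zero s hq0)
      rw [mul_assoc, hA, pow_succ (-1:F)]
      linear_combination (E * tt q s (s+d+1) * (q^s - q^(s+d+1))) * sg
    rw [hA2, inv_pow]
    field_simp
  rw [this]
  have hb := hBin_mem q h N hq
  exact N.mul_mem (N.mul_mem (N.mul_mem (hb _ _) (hb _ _)) (N.pow_mem hq _)) (N.pow_mem hqi _)

end helpers

lemma qv_ne (n : ℕ) : qv n ≠ 0 := by
  unfold qv
  rw [Ne, FaithfulSMul.algebraMap_eq_zero_iff]
  exact MvPolynomial.X_ne_zero _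

lemma qv_pow_ne (n m : ℕ) : 1 - qv n ^ (m+1) ≠ 0 := by
  unfold qv
  rw [← map_pow, ← map_one (algebraMap (MvPolynomial (Option (Fin n)) ℚ) (Fn n)), ← map_sub, Ne,
    FaithfulSMul.algebraMap_eq_zero_iff]
  intro hh
  have := congrArg (MvPolynomial.eval (fun _ => (0:ℚ))) hh
  simp at this

noncomputable def NN (n : ℕ) : Subsemiring (Fn n) :=
  Subsemiring.closure (insert (qv n) (insert (qv n)⁻¹ (Set.range (xv n))))

lemma S_mem (n : ℕ) : ∃ g ∈ TMod (qv n) (NN n), ∀ k : Fin n, S (qv n) (xv n) k = g k := by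
  refine ⟨∑ i : Fin n, fun k => xv n i * TT (qv n) i k, ?_, ?_⟩
  · refine AddSubmonoid.sum_mem _ (fun i _ => Mod_gen _ _ _ ?_ _)
    exact Subsemiring.subset_closure (Or.inr (Or.inr ⟨i, rfl⟩))
  · intro k
    rw [Finset.sum_apply]
    unfold S
    have e : ∀ i : Fin ((k:ℕ)+1), qBin (qv n) ((k : ℕ) + i) (2 * i) * qBin (qv n) (2 * i) i *
        (qv n ^ ((k : ℕ) * i))⁻¹ * xv n (Fin.castLE k.isLt i)
        = (fun j : Fin n => xv n j * TT (qv n) j k) (Fin.castLE k.isLt i) := by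
      intro i
      rw [TT_eq _ (qv_ne n) (qv_pow_ne n) _ _ (by omega)]
      simp [mul_comm]
    rw [Finset.sum_congr rfl (fun i _ => e i)]
    refine Fintype.sum_of_injective (Fin.castLE k.isLt) (Fin.castLE_injective _) _ _ ?_ (fun _ => rfl)
    intro j hj
    rw [TT_vanish, mul_zero]
    by_contra hlt
    exact hj ⟨⟨j, by omega⟩, by ext; rfl⟩

lemma rep (n : ℕ) (a : Fn n) (ha : a ∈ NN n) : ∃ f : ((Fin n →₀ ℕ) × ℤ) →₀ ℕ,
    a = f.sum fun p b => (b : Fn n) * (p.1.prod fun j e => xv n j ^ e) * qv n ^ p.2 := by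
  have hadd : ∀ f g : ((Fin n →₀ ℕ) × ℤ) →₀ ℕ,
      ((f+g).sum fun p b => (b : Fn n) * (p.1.prod fun j e => xv n j ^ e) * qv n ^ p.2)
      = (f.sum fun p b => (b : Fn n) * (p.1.prod fun j e => xv n j ^ e) * qv n ^ p.2)
       + (g.sum fun p b => (b : Fn n) * (p.1.prod fun j e => xv n j ^ e) * qv n ^ p.2) := by
    intro f g
    apply Finsupp.sum_add_index'
    · intro p; simp
    · intro p b c; push_cast; ring
  have hsingle : ∀ (p : (Fin n →₀ ℕ) × ℤ) (b : ℕ), 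
      ((Finsupp.single p b).sum fun p b => (b : Fn n) * (p.1.prod fun j e => xv n j ^ e) * qv n ^ p.2)
      = (b : Fn n) * (p.1.prod fun j e => xv n j ^ e) * qv n ^ p.2 := by
    intro p b
    apply Finsupp.sum_single_index
    simp
  induction ha using Subsemiring.closure_induction with
  | zero => exact ⟨0, by simp⟩
  | one => exact ⟨Finsupp.single (0, 0) 1, by rw [hsingle]; simp⟩
  | add x y _ _ hx hy =>
    obtain ⟨f, rfl⟩ := hx
    obtain ⟨g, rfl⟩ := hy
    exact ⟨f+g, (hadd f g).symm⟩
  | mem x hx =>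
    rcases hx with rfl | rfl | ⟨i, rfl⟩
    · exact ⟨Finsupp.single (0, 1) 1, by rw [hsingle]; simp⟩
    · exact ⟨Finsupp.single (0, -1) 1, by rw [hsingle]; simp⟩
    · exact ⟨Finsupp.single (Finsupp.single i 1, 0) 1, by rw [hsingle]; simp⟩
  | mul x y _ _ hx hy =>
    obtain ⟨f, hf⟩ := hx
    obtain ⟨g, hg⟩ := hy
    rw [hf, hg]
    clear hf hg
    induction f using Finsupp.induction_linear with
    | zero => exact ⟨0, by simp⟩
    | add f1 f2 h1 h2 =>
      obtain ⟨u, hu⟩ := h1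
      obtain ⟨v, hv⟩ := h2
      exact ⟨u+v, by rw [hadd, hadd, add_mul, hu, hv]⟩
    | single p b =>
      induction g using Finsupp.induction_linear with
      | zero => exact ⟨0, by simp⟩
      | add f1 f2 h1 h2 =>
        obtain ⟨u, hu⟩ := h1
        obtain ⟨v, hv⟩ := h2
        exact ⟨u+v, by rw [hadd, hadd, mul_add, hu, hv]⟩
      | single p' b' =>
        refine ⟨Finsupp.single (p+p') (b*b'), ?_⟩
        rw [hsingle, hsingle, hsingle, Prod.fst_add, Prod.snd_add, zpow_add₀ (qv_ne n),
          Finsupp.prod_add_index' (by simp) (fun _ _ _ => pow_add _ _ _)]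
        push_cast
        ring

theorem S_sums_nonneg_coeffs (n r : ℕ) (hn : 0 < n) (hr : 0 < r) :
    (∃ f : ((Fin n →₀ ℕ) × ℤ) →₀ ℕ,
        ∑ k : Fin n,
            (1 - qv n ^ (2 * (k : ℕ) + 1)) / (1 - qv n ^ n) * S (qv n) (xv n) k ^ r *
              (qv n ^ (k : ℕ))⁻¹ =
          f.sum fun p b => (b : Fn n) * (p.1.prod fun j e => xv n j ^ e) * qv n ^ p.2) ∧
    (∃ f : ((Fin n →₀ ℕ) × ℤ) →₀ ℕ,
        ∑ k : Fin n,
            (-1 : Fn n) ^ (n - (k : ℕ) - 1) *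
              ((1 - qv n ^ (2 * (k : ℕ) + 1)) / (1 - qv n ^ n)) *
              S (qv n) (xv n) k ^ r * qv n ^ ((k : ℕ) * ((k : ℕ) - 1) / 2) =
          f.sum fun p b => (b : Fn n) * (p.1.prod fun j e => xv n j ^ e) * qv n ^ p.2) := by
  have hq : qv n ∈ NN n := Subsemiring.subset_closure (Or.inl rfl)
  have hqi : (qv n)⁻¹ ∈ NN n := Subsemiring.subset_closure (Or.inr (Or.inl rfl))
  obtain ⟨g, hg, hS⟩ := S_mem n
  have hgr := Mod_pow (qv n) (qv_ne n) (qv_pow_ne n) (NN n) hq hqi g hg r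
  constructor
  · apply rep
    have := Mod_linear (qv n) (NN n) n _
      (wA (qv n) (qv_ne n) (qv_pow_ne n) (NN n) hq hqi n) _ hgr
    rw [Finset.sum_range] at this
    convert this using 2 with k
    rw [hS, Pi.pow_apply]
    ring
  · apply rep
    have := Mod_linear (qv n) (NN n) n _
      (wB (qv n) (qv_ne n) (qv_pow_ne n) (NN n) hq hqi n) _ hgr
    rw [Finset.sum_range] at this
    convert this using 2 with k
    rw [hS, Pi.pow_apply]
    ring
end
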